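/- A binary word with no internal maximum block is a minimal non palindrome pair if and only if it equals 11(01)^n00 or 00(10)^n11 for some integer n ≥ 1. -/

import Mathlib

/-- A word over {0,1} (represented as `List Bool`) is a *palindrome pair*
if it is a concatenation of two palindromes. -/
def PalPair (w : List Bool) : Prop :=
  ∃ p q : List Bool, p.Palindrome ∧ q.Palindrome ∧ w = p ++ q

/-- `u` is a proper factor of `w`: a factor (contiguous subword) other than
`w` itself. -/
def ProperFactor (u w : List Bool) : Prop :=
  u <:+: w ∧ u ≠ w

/-- A *minimal non palindrome pair*: a word that is not a palindrome pair but
all of whose proper factors are palindrome pairs. -/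
def MNPP (w : List Bool) : Prop :=
  ¬ PalPair w ∧ ∀ u, ProperFactor u w → PalPair u

/-- `IsBlock w c m` says that `w` has a block (maximal run) of the letter `c`
of length `m`: an occurrence of `c^m` that cannot be extended on either side. -/
def IsBlock (w : List Bool) (c : Bool) (m : ℕ) : Prop :=
  0 < m ∧ ∃ p s : List Bool, w = p ++ List.replicate m c ++ s ∧
    p.getLast? ≠ some c ∧ s.head? ≠ some c

/-- `w` has an *internal maximum block*: a block that is neither the first nor
last block of `w` (so it is flanked on both sides by the other letter) and
whose length is at least that of every block of `w`. -/
def HasInternalMaxBlock (w : List Bool) : Prop :=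
  ∃ (c : Bool) (m : ℕ) (u v : List Bool), 0 < m ∧
    w = u ++ List.replicate m c ++ v ∧
    u.getLast? = some (!c) ∧ v.head? = some (!c) ∧
    ∀ c' m', IsBlock w c' m' → m' ≤ m

theorem palPair_iff (w : List Bool) :
    PalPair w ↔ ∃ p q : List Bool, p.reverse = p ∧ q.reverse = q ∧ w = p ++ q := by
  simp only [PalPair, List.Palindrome.iff_reverse_eq]

theorem PalPair.reverse {w : List Bool} (h : PalPair w) : PalPair w.reverse := by
  rw [palPair_iff] at h ⊢
  obtain ⟨p, q, hp, hq, rfl⟩ := h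
  exact ⟨q, p, hq, hp, by rw [List.reverse_append, hp, hq]⟩

theorem palPair_reverse {w : List Bool} : PalPair w.reverse ↔ PalPair w :=
  ⟨fun h => by simpa using h.reverse, PalPair.reverse⟩

theorem MNPP.reverse {w : List Bool} (h : MNPP w) : MNPP w.reverse := by
  refine ⟨fun hw => h.1 (palPair_reverse.1 hw), fun u hu => palPair_reverse.1 (h.2 _ ⟨?_, ?_⟩)⟩
  · simpa using List.IsInfix.reverse hu.1
  · intro e
    exact hu.2 (by rw [← e, List.reverse_reverse])

/-- The word `cc(dc)^n dd`, where `d` is the letter other than `c`. -/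
def extremalWord (c : Bool) (n : ℕ) : List Bool :=
  [c, c] ++ (List.replicate n [!c, c]).flatten ++ [!c, !c]

theorem reverse_flatten_replicate_pair (a b : Bool) (n : ℕ) :
    (List.replicate n [a, b]).flatten.reverse = (List.replicate n [b, a]).flatten := by
  simp [List.reverse_flatten]

theorem reverse_extremalWord (c : Bool) (n : ℕ) :
    (extremalWord c n).reverse = extremalWord (!c) n := by
  simp only [extremalWord, List.reverse_append, reverse_flatten_replicate_pair]
  simp

theorem not_repeated_letter_in_tail (c : Bool) (n : ℕ) (x y : List Bool) :
    c :: ((List.replicate n [!c, c]).flatten ++ [!c, !c]) ≠ x ++ c :: c :: y := by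
  induction n generalizing x with
  | zero =>
    rcases x with _ | ⟨_, _ | ⟨_, _ | ⟨_, x⟩⟩⟩ <;> simp
  | succ n ih =>
    rcases x with _ | ⟨_, _ | ⟨_, x⟩⟩
    · simp [List.replicate_succ]
    · simp [List.replicate_succ]
    · intro h
      simp only [List.replicate_succ, List.flatten_cons, List.cons_append, List.nil_append,
        List.cons.injEq] at h
      exact ih x h.2.2

theorem length_palindrome_prefix_extremalWord {c : Bool} {n : ℕ} {p q : List Bool}
    (hp : p.reverse = p) (h : extremalWord c n = p ++ q) : p.length ≤ 2 := by
  rcases p with _ | ⟨a, _ | ⟨b, p⟩⟩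
  · simp
  · simp
  have h' := h
  simp only [extremalWord, List.cons_append, List.nil_append, List.cons.injEq] at h'
  obtain ⟨rfl, rfl, -⟩ := h'
  rw [← hp] at h
  rcases hr : p.reverse with _ | ⟨d, r⟩
  · simpa using hr
  · simp only [extremalWord, List.reverse_cons, hr, List.cons_append, List.nil_append,
      List.append_assoc, List.cons.injEq] at h
    exact absurd h.2 (not_repeated_letter_in_tail c n r q)

theorem not_palPair_extremalWord (c : Bool) {n : ℕ} (hn : 1 ≤ n) :
    ¬ PalPair (extremalWord c n) := by
  rw [palPair_iff]
  rintro ⟨p, q, hp, hq, h⟩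
  have h₁ := length_palindrome_prefix_extremalWord hp h
  have h₂ : extremalWord (!c) n = q ++ p := by
    rw [← reverse_extremalWord, h, List.reverse_append, hp, hq]
  have h₃ := length_palindrome_prefix_extremalWord hq h₂
  have h₄ := congrArg List.length h
  simp [extremalWord] at h₄
  omega

theorem reverse_eq_self_of_isChain_ne {v : List Bool} (hv : v.IsChain (· ≠ ·))
    (hodd : Odd v.length) : v.reverse = v := by
  have key : ∀ (k : ℕ) (v : List Bool), v.IsChain (· ≠ ·) → v.length = 2 * k + 1 →
      ∃ a, v = (List.replicate k [a, !a]).flatten ++ [a] := by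
    intro k
    induction k with
    | zero =>
      intro v _ hl
      obtain ⟨a, rfl⟩ := List.length_eq_one_iff.1 hl
      exact ⟨a, rfl⟩
    | succ k ih =>
      intro v hv hl
      rcases v with _ | ⟨a, _ | ⟨b, v⟩⟩
      · simp at hl
      · simp at hl
      rw [List.isChain_cons_cons] at hv
      obtain ⟨d, rfl⟩ := ih v hv.2.tail (by simp at hl; omega)
      refine ⟨a, ?_⟩
      have hb : b = !a := by
        have := hv.1
        revert this; cases a <;> cases b <;> simp
      have hd : d = a := by
        have h2 := hv.2
        cases k with
        | zero =>
          simp at h2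
          revert h2; subst hb; cases a <;> cases d <;> simp
        | succ k =>
          simp [List.replicate_succ] at h2
          have h3 := h2.1
          revert h3; subst hb; cases a <;> cases d <;> simp
      subst hb hd
      simp [List.replicate_succ]
  obtain ⟨k, hk⟩ := hodd
  obtain ⟨a, rfl⟩ := key k v hv hk
  have comm : ∀ k : ℕ, a :: (List.replicate k [!a, a]).flatten =
      (List.replicate k [a, !a]).flatten ++ [a] := by
    intro k
    induction k with
    | zero => rfl
    | succ k ih => simp [List.replicate_succ, ← ih]
  rw [List.reverse_append, reverse_flatten_replicate_pair]
  exact comm k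

theorem palPair_of_isChain_ne {v : List Bool} (hv : v.IsChain (· ≠ ·)) : PalPair v := by
  rw [palPair_iff]
  rcases Nat.even_or_odd v.length with he | ho
  · rcases v with _ | ⟨a, v⟩
    · exact ⟨[], [], rfl, rfl, rfl⟩
    · refine ⟨[a], v, rfl, reverse_eq_self_of_isChain_ne hv.tail ?_, rfl⟩
      simpa [Nat.even_add_one] using he
  · exact ⟨[], v, rfl, reverse_eq_self_of_isChain_ne hv ho, rfl⟩

theorem palPair_cons_of_isChain_ne {c : Bool} {v : List Bool} (hv : (c :: v).IsChain (· ≠ ·)) :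
    PalPair (c :: c :: v) := by
  rw [palPair_iff]
  rcases Nat.even_or_odd v.length with he | ho
  · exact ⟨[c], c :: v, rfl, reverse_eq_self_of_isChain_ne hv (by simpa using he.add_one), rfl⟩
  · exact ⟨[c, c], v, rfl, reverse_eq_self_of_isChain_ne hv.tail ho, rfl⟩

theorem isChain_ne_alternating (c : Bool) (n : ℕ) :
    (c :: ((List.replicate n [!c, c]).flatten ++ [!c])).IsChain (· ≠ ·) := by
  induction n with
  | zero => simp
  | succ n ih => simpa [List.replicate_succ] using ih

theorem isChain_of_isInfix {u v : List Bool} (hv : v.IsChain (· ≠ ·)) (hu : u <:+: v) :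
    u.IsChain (· ≠ ·) := by
  obtain ⟨x, y, rfl⟩ := hu
  exact hv.left_of_append.right_of_append

theorem palPair_of_infix_dropLast_extremalWord {c : Bool} {n : ℕ} {u : List Bool}
    (hu : u <:+: (extremalWord c n).dropLast) : PalPair u := by
  have hL := isChain_ne_alternating c n
  have e : (extremalWord c n).dropLast =
      c :: c :: ((List.replicate n [!c, c]).flatten ++ [!c]) := by
    have : extremalWord c n =
        (c :: c :: ((List.replicate n [!c, c]).flatten ++ [!c])) ++ [!c] := by
      simp [extremalWord]
    rw [this, List.dropLast_concat]
  rw [e, List.infix_cons_iff] at hu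
  rcases hu with hu | hu
  · rcases u with _ | ⟨a, _ | ⟨b, v⟩⟩
    · exact palPair_of_isChain_ne (by simp)
    · exact palPair_of_isChain_ne (by simp)
    · simp only [List.cons_prefix_cons] at hu
      obtain ⟨rfl, rfl, hv⟩ := hu
      exact palPair_cons_of_isChain_ne
        (isChain_of_isInfix hL (List.cons_prefix_cons.2 ⟨rfl, hv⟩).isInfix)
  · exact palPair_of_isChain_ne (isChain_of_isInfix hL hu)

theorem mnpp_extremalWord (c : Bool) {n : ℕ} (hn : 1 ≤ n) : MNPP (extremalWord c n) := by
  have drop : ∀ (w x u y : List Bool), x ++ u ++ y = w → y ≠ [] → u <:+: w.dropLast := by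
    rintro _ x u y rfl hy
    exact ⟨x, y.dropLast, by rw [List.dropLast_append_of_ne_nil hy]⟩
  refine ⟨not_palPair_extremalWord c hn, ?_⟩
  rintro u ⟨⟨x, y, h⟩, hne⟩
  by_cases hy : y = []
  · have hx : x.reverse ≠ [] := by
      rintro hx
      exact hne (by simpa [hy, List.reverse_eq_nil_iff.1 hx] using h)
    have h' : y.reverse ++ u.reverse ++ x.reverse = extremalWord (!c) n := by
      rw [← reverse_extremalWord, ← h]
      simp
    exact palPair_reverse.1
      (palPair_of_infix_dropLast_extremalWord (drop _ _ _ _ h' hx))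
  · exact palPair_of_infix_dropLast_extremalWord (drop _ _ _ _ h hy)

/-- No run of a single letter in `w` is longer than `M`. -/
def RunsAtMost (w : List Bool) (M : ℕ) : Prop :=
  ∀ (d : Bool) (k : ℕ), List.replicate k d <:+: w → k ≤ M

/-- No internal block of `w` has length exactly `M`. -/
def NoInternalBlock (w : List Bool) (M : ℕ) : Prop :=
  ∀ d : Bool, ¬ (!d) :: (List.replicate M d ++ [!d]) <:+: w

theorem RunsAtMost.reverse {w : List Bool} {M : ℕ} (h : RunsAtMost w M) :
    RunsAtMost w.reverse M := fun d k hk =>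
  h d k (by simpa using List.IsInfix.reverse hk)

theorem NoInternalBlock.reverse {w : List Bool} {M : ℕ} (h : NoInternalBlock w M) :
    NoInternalBlock w.reverse M := fun d hd =>
  h d (by simpa using List.IsInfix.reverse hd)

theorem bool_eq_or_eq_not (c d : Bool) : d = c ∨ d = !c := by
  cases c <;> cases d <;> simp

section LeadingMaxRun

variable {c : Bool} {M : ℕ} {u : List Bool}

theorem tail_ne_cons_of_runsAtMost (hB : RunsAtMost (List.replicate M c ++ u) M)
    (y : List Bool) : u ≠ c :: y := by
  rintro rfl
  have := hB c (M + 1) ⟨[], y, by simp [List.replicate_succ']⟩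
  omega

theorem eq_nil_of_block_of_length_max (hB : RunsAtMost (List.replicate M c ++ u) M)
    (hI : NoInternalBlock (List.replicate M c ++ u) M) {x y : List Bool}
    (h : List.replicate M c ++ u = x ++ (!c) :: (List.replicate M c ++ y)) : y = [] := by
  rcases y with _ | ⟨d, y⟩
  · rfl
  rcases bool_eq_or_eq_not c d with rfl | rfl
  · have := hB d (M + 1) ⟨x ++ [!d], y, by rw [h]; simp [List.replicate_succ']⟩
    omega
  · exact absurd ⟨x, y, by rw [h]; simp⟩ (hI c)

theorem properFactor_of_append {x v y : List Bool} (h : x ≠ [] ∨ y ≠ []) :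
    ProperFactor v (x ++ v ++ y) := by
  refine ⟨⟨x, y, rfl⟩, fun e => ?_⟩
  have := congrArg List.length e
  simp only [List.length_append] at this
  rcases h with h | h <;> have := List.length_pos_iff.2 h <;> omega

theorem exists_palindrome_extension (hB : RunsAtMost (List.replicate M c ++ u) M)
    (hI : NoInternalBlock (List.replicate M c ++ u) M)
    (hw : MNPP (List.replicate M c ++ u)) {v y : List Bool} (huv : u = v ++ y) (hy : y ≠ []) :
    ∃ i ≤ M, (List.replicate i c ++ v).reverse = List.replicate i c ++ v := by
  have hp : PalPair (List.replicate M c ++ v) := by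
    refine hw.2 _ ?_
    have := properFactor_of_append (x := []) (v := List.replicate M c ++ v) (Or.inr hy)
    simpa [huv] using this
  rw [palPair_iff] at hp
  obtain ⟨p, q, hp, hq, h⟩ := hp
  rcases List.append_eq_append_iff.1 h with ⟨p', rfl, rfl⟩ | ⟨a, ha, rfl⟩
  · rcases p' with _ | ⟨d, p'⟩
    · exact ⟨0, by simp, by simpa using hq⟩
    · exfalso
      rcases bool_eq_or_eq_not c d with rfl | rfl
      · exact tail_ne_cons_of_runsAtMost hB _ huv
      · have e : List.replicate M c ++ u =
            p'.reverse ++ (!c) :: (List.replicate M c ++ (q ++ y)) := by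
          rw [huv, ← List.append_assoc, ← List.append_assoc, ← hp]
          simp
        simpa [hy] using eq_nil_of_block_of_length_max hB hI e
  · obtain ⟨-, -, ha'⟩ := List.append_eq_replicate_iff.1 ha.symm
    rw [ha'] at hq
    refine ⟨a.length, ?_, hq⟩
    have := congrArg List.length ha
    simp at this
    omega

theorem exists_eq_append_not (hB : RunsAtMost (List.replicate M c ++ u) M)
    (hI : NoInternalBlock (List.replicate M c ++ u) M)
    (hw : MNPP (List.replicate M c ++ u)) : ∃ t, u = t ++ [!c] := by
  rcases u.eq_nil_or_concat with rfl | ⟨t, d, rfl⟩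
  · exact absurd ((palPair_iff _).2 ⟨List.replicate M c, [], by simp, rfl, rfl⟩) hw.1
  rw [List.concat_eq_append] at *
  rcases bool_eq_or_eq_not c d with rfl | rfl
  · exfalso
    obtain ⟨i, hi, h⟩ := exists_palindrome_extension hB hI hw rfl (by simp)
    rcases hi.lt_or_eq with hi | rfl
    · refine hw.1 ((palPair_iff _).2 ⟨List.replicate (M - (i + 1)) d,
        d :: (List.replicate i d ++ t) ++ [d], by simp, ?_, ?_⟩)
      · rw [List.reverse_append, List.reverse_cons (as := List.replicate i d ++ t), h]
        simp
      · have : M = (M - (i + 1)) + (i + 1) := by omega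
        conv_lhs => rw [this, List.replicate_add, List.replicate_succ]
        simp
    · have := hB d (i + 1) ⟨t.reverse, [], by
        rw [← List.append_assoc, ← h]; simp [List.replicate_succ']⟩
      omega
  · exact ⟨t, rfl⟩

theorem reverse_prefix_eq_self (hB : RunsAtMost (List.replicate M c ++ u) M)
    (hI : NoInternalBlock (List.replicate M c ++ u) M)
    (hw : MNPP (List.replicate M c ++ u)) {x y : List Bool} (hu : u = x ++ (!c) :: y)
    (hy : y ≠ []) : (!c) :: x.reverse = x ++ [!c] := by
  obtain ⟨i, -, h⟩ := exists_palindrome_extension hB hI hw (v := x ++ [!c]) (y := y)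
    (by simp [hu]) hy
  rcases i with _ | i
  · simpa using h
  · simp [List.replicate_succ] at h

theorem not_palindrome_tail (hw : MNPP (List.replicate M c ++ u)) : u.reverse ≠ u := fun h =>
  hw.1 ((palPair_iff _).2 ⟨_, u, by simp, h, rfl⟩)

/-- For every `k < M`, the block `c^k` occurs between two other letters at the beginning
or at the end of `u`. -/
theorem short_block_at_end (hB : RunsAtMost (List.replicate M c ++ u) M)
    (hI : NoInternalBlock (List.replicate M c ++ u) M)
    (hw : MNPP (List.replicate M c ++ u)) {k : ℕ} (hk : k < M) :
    (∃ x, u = x ++ (!c) :: (List.replicate k c ++ [!c])) ∨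
      ∃ y, u = (!c) :: (List.replicate k c ++ (!c) :: y) := by
  obtain ⟨t, ht⟩ := exists_eq_append_not hB hI hw
  have hsplit : ∀ j, j ≤ M →
      List.replicate M c = List.replicate (M - j) c ++ List.replicate j c := by
    intro j hj
    rw [← List.replicate_add]
    congr 1
    omega
  have hp : PalPair (List.replicate k c ++ u) := by
    refine hw.2 _ ?_
    have := properFactor_of_append (x := List.replicate (M - k) c)
      (v := List.replicate k c ++ u) (y := [])
      (Or.inl (by simp; omega))
    rw [hsplit k hk.le]
    simpa only [List.append_nil, List.append_assoc] using this
  rw [palPair_iff] at hp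
  obtain ⟨p, q, hp, hq, h⟩ := hp
  rcases List.append_eq_append_iff.1 h with ⟨p', rfl, hu⟩ | ⟨a, ha, rfl⟩
  · rcases p' with _ | ⟨d, p⟩
    · exact absurd (by simpa [hu] using hq) (not_palindrome_tail hw)
    rcases bool_eq_or_eq_not c d with rfl | rfl
    · exact absurd hu (tail_ne_cons_of_runsAtMost hB _)
    have hp' : List.replicate k c ++ (!c) :: p = p.reverse ++ (!c) :: List.replicate k c := by
      rw [← hp]
      simp
    obtain ⟨a, ha⟩ : ∃ a, (!c) :: p = a ++ (!c) :: List.replicate k c := by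
      rcases List.append_eq_append_iff.1 hp' with ⟨a, -, ha⟩ | ⟨a, ha, ha'⟩
      · exact ⟨a, ha⟩
      · rcases a with _ | ⟨d, a⟩
        · exact ⟨[], by simpa using ha'.symm⟩
        · have hd : d = c := List.eq_of_mem_replicate (n := k) (by rw [ha]; simp)
          subst hd
          simp at ha'
    rw [ha] at hu
    rcases q.eq_nil_or_concat with rfl | ⟨q, d, rfl⟩
    · exfalso
      rcases k with _ | k
      · exact not_palindrome_tail hw (by
          rw [← ha, List.append_nil] at hu
          simpa [hu] using hp)
      · rw [ht, List.replicate_succ'] at hu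
        have := congrArg List.reverse hu
        simp at this
    · rw [List.concat_eq_append] at *
      have hd : d = !c := by
        rw [ht] at hu
        have := congrArg List.getLast? hu
        simpa [eq_comm, List.getLast?_cons] using this
      subst hd
      have hq' : q ++ [!c] = (!c) :: q.reverse := by
        rw [← hq]; simp
      rw [hq'] at hu
      by_cases hq0 : q.reverse = []
      · left
        exact ⟨a, by simpa [hq0] using hu⟩
      · right
        have := reverse_prefix_eq_self hB hI hw
          (x := a ++ (!c) :: List.replicate k c) hu hq0
        refine ⟨a.reverse ++ q.reverse, ?_⟩
        rw [hu, List.append_cons _ (!c), ← this]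
        simp
  · exfalso
    refine hw.1 ((palPair_iff _).2 ⟨List.replicate (M - k) c ++ p, a ++ u, ?_, hq, ?_⟩)
    · obtain ⟨-, hp', -⟩ := List.append_eq_replicate_iff.1 ha.symm
      rw [hp', ← List.replicate_add, List.reverse_replicate]
    · rw [hsplit k hk.le, ha]
      simp

theorem prefix_eq_alternating (hB : RunsAtMost (List.replicate M c ++ u) M)
    (hI : NoInternalBlock (List.replicate M c ++ u) M)
    (hw : MNPP (List.replicate M c ++ u)) {z : List Bool} (hz : u = (!c) :: c :: (!c) :: z) :
    ∀ (x y : List Bool), y ≠ [] → u = x ++ (!c) :: y →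
      ∃ l, x = (List.replicate l [!c, c]).flatten := by
  intro x
  induction h : x.length using Nat.strong_induction_on generalizing x with
  | _ n ih =>
    intro y hy hu
    have hp := reverse_prefix_eq_self hB hI hw hu hy
    rcases x with _ | ⟨a, _ | ⟨b, x⟩⟩
    · exact ⟨0, rfl⟩
    · simp [hz] at hu
    have hab := hu
    have hu' := hu
    rw [hz] at hab
    simp only [List.cons_append, List.cons.injEq] at hab
    obtain ⟨rfl, rfl, -⟩ := hab
    simp only [List.reverse_cons, List.append_assoc] at hp
    rcases x with _ | ⟨d, x⟩
    · exact ⟨1, rfl⟩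
    rw [hz] at hu
    simp only [List.cons_append, List.cons.injEq, true_and] at hu
    obtain ⟨rfl, -⟩ := hu
    have hx : (!c) :: c :: (!c) :: x = ((!c) :: x.reverse) ++ [!c, c] := by
      apply List.append_cancel_right (bs := [!c])
      rw [← hp]
      simp
    rw [hx] at hu' ⊢
    obtain ⟨l, hl⟩ := ih _ (by simp at h ⊢; omega) ((!c) :: x.reverse) rfl (c :: (!c) :: y)
      (by simp) (by rw [hu']; simp)
    exact ⟨l + 1, by rw [hl, List.replicate_succ', List.flatten_append]; simp⟩

theorem not_run_lt_run {c : Bool} {j k : ℕ} {y y' : List Bool} (hjk : j < k) :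
    List.replicate j c ++ (!c) :: y ≠ List.replicate k c ++ (!c) :: y' := by
  obtain ⟨m, rfl⟩ := Nat.exists_eq_add_of_lt hjk
  rw [add_assoc, List.replicate_add, List.append_assoc, ne_eq, List.append_cancel_left_eq]
  simp [List.replicate_succ]

theorem eq_extremalWord (hM : 0 < M) (hB : RunsAtMost (List.replicate M c ++ u) M)
    (hI : NoInternalBlock (List.replicate M c ++ u) M)
    (hw : MNPP (List.replicate M c ++ u)) :
    ∃ n, 1 ≤ n ∧ List.replicate M c ++ u = extremalWord c n := by
  have h₀ := short_block_at_end hB hI hw hM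
  have hM₁ : 1 < M := by
    refine hB (!c) 2 ?_
    rcases h₀ with ⟨x, rfl⟩ | ⟨y, rfl⟩
    · exact ⟨List.replicate M c ++ x, [], by simp⟩
    · exact ⟨List.replicate M c, y, by simp⟩
  have h₁ := short_block_at_end hB hI hw hM₁
  have hM₂ : M = 2 := by
    by_contra hne
    have h₂ := short_block_at_end hB hI hw (k := 2) (by omega)
    have hend : ∀ {j k : ℕ} {x x' : List Bool}, u = x ++ (!c) :: (List.replicate j c ++ [!c]) →
        u = x' ++ (!c) :: (List.replicate k c ++ [!c]) → j < k → False := by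
      intro j k x x' h h' hjk
      have := congrArg List.reverse (h.symm.trans h')
      simp only [List.reverse_append, List.reverse_cons, List.reverse_replicate,
        List.reverse_nil, List.nil_append, List.append_assoc, List.cons_append,
        List.cons.injEq, true_and] at this
      exact not_run_lt_run hjk this
    have hstart : ∀ {j k : ℕ} {y y' : List Bool}, u = (!c) :: (List.replicate j c ++ (!c) :: y) →
        u = (!c) :: (List.replicate k c ++ (!c) :: y') → j < k → False := by
      intro j k y y' h h' hjk
      exact not_run_lt_run hjk (List.cons.inj (h.symm.trans h')).2
    rcases h₀ with ⟨_, h₀⟩ | ⟨_, h₀⟩ <;> rcases h₁ with ⟨_, h₁⟩ | ⟨_, h₁⟩ <;>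
      rcases h₂ with ⟨_, h₂⟩ | ⟨_, h₂⟩ <;>
      first
      | exact hend h₀ h₁ (by omega)
      | exact hend h₀ h₂ (by omega)
      | exact hend h₁ h₂ (by omega)
      | exact hstart h₀ h₁ (by omega)
      | exact hstart h₀ h₂ (by omega)
      | exact hstart h₁ h₂ (by omega)
  subst hM₂
  have hstart : ∀ y, u ≠ (!c) :: (!c) :: y := by
    rintro (_ | ⟨d, y⟩) rfl
    · exact not_palindrome_tail hw rfl
    · rcases bool_eq_or_eq_not c d with rfl | rfl
      · exact hI (!d) ⟨[d], y, by simp [List.replicate_succ]⟩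
      · have := hB (!c) 3 ⟨[c, c], y, by simp [List.replicate_succ]⟩
        omega
  obtain ⟨x, hx⟩ := h₀.resolve_right (by rintro ⟨y, hy⟩; exact hstart y (by simpa using hy))
  obtain ⟨y, hy⟩ : ∃ y, u = (!c) :: (List.replicate 1 c ++ (!c) :: y) := by
    refine h₁.resolve_left ?_
    rintro ⟨x', hx'⟩
    have := congrArg List.reverse (hx.symm.trans hx')
    simp at this
  obtain ⟨l, rfl⟩ := prefix_eq_alternating hB hI hw (z := y) (by simpa using hy) x [!c]
    (by simp) (by simpa using hx)
  refine ⟨l, ?_, by rw [hx]; simp [extremalWord, List.replicate_succ]⟩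
  rcases l with _ | l
  · exact absurd (by simpa using hx) (hstart [])
  · omega

end LeadingMaxRun

theorem exists_max_run (w : List Bool) (hw : w ≠ []) :
    ∃ (M : ℕ) (d : Bool), 0 < M ∧ RunsAtMost w M ∧ List.replicate M d <:+: w := by
  classical
  let P : ℕ → Prop := fun k => ∃ d : Bool, List.replicate k d <:+: w
  have hP : ∀ k, P k → k ≤ w.length := by
    rintro k ⟨d, hd⟩
    simpa using hd.length_le
  have h1 : P 1 := by
    rcases w with _ | ⟨a, w⟩
    · exact absurd rfl hw
    · exact ⟨a, [], w, rfl⟩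
  obtain ⟨d, hd⟩ : P (Nat.findGreatest P w.length) := Nat.findGreatest_spec (hP 1 h1) h1
  exact ⟨_, d, Nat.le_findGreatest (hP 1 h1) h1,
    fun d k hk => Nat.le_findGreatest (hP k ⟨d, hk⟩) ⟨d, hk⟩, hd⟩

theorem noInternalBlock_of_not_hasInternalMaxBlock {w : List Bool} (hM : 0 < M)
    (hB : RunsAtMost w M) (h : ¬ HasInternalMaxBlock w) : NoInternalBlock w M := by
  rintro d ⟨x, y, hxy⟩
  refine h ⟨d, M, x ++ [!d], (!d) :: y, hM, by simp [← hxy], by simp, by simp, ?_⟩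
  rintro c' m' ⟨-, p, s, e, -⟩
  exact hB c' m' ⟨p, s, e.symm⟩

theorem exists_eq_extremalWord {w : List Bool} (h : ¬ HasInternalMaxBlock w) (hw : MNPP w) :
    ∃ c n, 1 ≤ n ∧ w = extremalWord c n := by
  have hne : w ≠ [] := by
    rintro rfl
    exact hw.1 ((palPair_iff _).2 ⟨[], [], rfl, rfl, rfl⟩)
  obtain ⟨M, d, hM, hB, x, y, hxy⟩ := exists_max_run w hne
  have hI := noInternalBlock_of_not_hasInternalMaxBlock hM hB h
  rcases x.eq_nil_or_concat with rfl | ⟨x, a, rfl⟩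
  · obtain rfl : List.replicate M d ++ y = w := by simpa using hxy
    obtain ⟨n, hn, e⟩ := eq_extremalWord hM hB hI hw
    exact ⟨d, n, hn, e⟩
  · rw [List.concat_eq_append] at hxy
    have hy : y = [] := by
      rcases bool_eq_or_eq_not d a with rfl | rfl
      · have := hB a (M + 1) ⟨x, y, by rw [← hxy]; simp [List.replicate_succ]⟩
        omega
      rcases y with _ | ⟨b, y⟩
      · rfl
      rcases bool_eq_or_eq_not d b with rfl | rfl
      · have := hB b (M + 1) ⟨x ++ [!b], y, by rw [← hxy]; simp [List.replicate_succ']⟩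
        omega
      · exact absurd ⟨x, y, by rw [← hxy]; simp⟩ (hI d)
    have hr : w.reverse = List.replicate M d ++ (x ++ [a]).reverse := by
      rw [← hxy, hy]
      simp
    have hB' := hB.reverse
    have hI' := hI.reverse
    have hw' := hw.reverse
    rw [hr] at hB' hI' hw'
    obtain ⟨n, hn, e⟩ := eq_extremalWord hM hB' hI' hw'
    refine ⟨!d, n, hn, ?_⟩
    rw [← reverse_extremalWord, ← e, ← hr, List.reverse_reverse]

/-- A binary word with no internal maximum block is a minimal non palindrome
pair if and only if it is `11(01)^n00` or `00(10)^n11` for some `n ≥ 1`. -/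
theorem mnpp_no_internal_max_block (w : List Bool)
    (h : ¬ HasInternalMaxBlock w) :
    MNPP w ↔
      ∃ n : ℕ, 1 ≤ n ∧
        (w = [true, true] ++ (List.replicate n [false, true]).flatten ++
              [false, false] ∨
         w = [false, false] ++ (List.replicate n [true, false]).flatten ++
              [true, true]) := by
  constructor
  · intro hw
    obtain ⟨c, n, hn, rfl⟩ := exists_eq_extremalWord h hw
    refine ⟨n, hn, ?_⟩
    cases c
    · exact Or.inr rfl
    · exact Or.inl rfl
  · rintro ⟨n, hn, rfl | rfl⟩
    · exact mnpp_extremalWord true hn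
    · exact mnpp_extremalWord false hn
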